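/- arXiv:2002.05248 — 4 statements merged into one kernel-verified Lean document; each statement's English description precedes it below -/
import Mathlib

section
/- Let n be a nonnegative integer and set a = -n. Let b, c be real numbers such that c is not a nonpositive integer and c - b is not an integer. Then for all x with 0 < x < 1, ₂F₁(a, b; a+b+1-c; 1-x) = [Γ(c-a)·Γ(c-b) / (Γ(c)·Γ(c-a-b))] · ₂F₁(a, b; c; x), where Γ denotes the Euler Gamma function. -/
/-- The Gaussian hypergeometric series `₂F₁(a, b; c; x)` for real parameters,
defined as `∑ (a)_k (b)_k / ((c)_k k!) x^k` where `(a)_k` is the rising factorial. -/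
noncomputable def hyp2F1 (a b c x : ℝ) : ℝ :=
  ∑' k : ℕ, (ascPochhammer ℝ k).eval a * (ascPochhammer ℝ k).eval b /
      ((ascPochhammer ℝ k).eval c * (Nat.factorial k : ℝ)) * x ^ k

open Polynomial Finset

theorem ascPochhammer_succ_eval_left (n : ℕ) (r : ℝ) :
    (ascPochhammer ℝ (n + 1)).eval r = r * (ascPochhammer ℝ n).eval (r + 1) := by
  simp [ascPochhammer_succ_left]

theorem ascPochhammer_eval_add_index (m n : ℕ) (r : ℝ) :
    (ascPochhammer ℝ (m + n)).eval r =
      (ascPochhammer ℝ m).eval r * (ascPochhammer ℝ n).eval (r + m) := by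
  simp [← ascPochhammer_mul]

theorem ascPochhammer_eval_reflect (i j : ℕ) (d : ℝ) :
    (ascPochhammer ℝ i).eval (1 - d - ((i + j : ℕ) : ℝ)) * (ascPochhammer ℝ j).eval d =
      (-1) ^ i * (ascPochhammer ℝ (i + j)).eval d := by
  induction i with
  | zero => simp
  | succ i ih =>
    have h : 1 - d - ((i + 1 + j : ℕ) : ℝ) + 1 = 1 - d - ((i + j : ℕ) : ℝ) := by
      push_cast; ring
    rw [ascPochhammer_succ_eval_left, h, mul_assoc, ih, Nat.add_right_comm i 1 j,
      ascPochhammer_succ_eval]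
    push_cast
    ring

theorem ascPochhammer_eval_neg_natCast_add (i j : ℕ) :
    (ascPochhammer ℝ i).eval (-((i + j : ℕ) : ℝ)) =
      (-1) ^ i * ((i + j).choose i : ℝ) * (i.factorial : ℝ) := by
  have h := ascPochhammer_eval_reflect i j 1
  rw [ascPochhammer_eval_one, ascPochhammer_eval_one, sub_self, zero_sub,
    ← Nat.add_choose_mul_factorial_mul_factorial i j, ← Nat.choose_symm_add] at h
  refine mul_right_cancel₀ (Nat.cast_ne_zero.2 j.factorial_ne_zero) (h.trans ?_)
  push_cast
  ring

theorem hyp2F1_neg_natCast (n : ℕ) (b c x : ℝ) :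
    hyp2F1 (-(n : ℝ)) b c x =
      ∑ ij ∈ antidiagonal n, (n.choose ij.1 : ℝ) *
        ((ascPochhammer ℝ ij.1).eval b / (ascPochhammer ℝ ij.1).eval c * (-x) ^ ij.1) := by
  rw [hyp2F1, tsum_eq_sum (s := range (n + 1)),
    ← Nat.sum_antidiagonal_eq_sum_range_succ_mk (f := fun ij : ℕ × ℕ =>
      (ascPochhammer ℝ ij.1).eval (-(n : ℝ)) * (ascPochhammer ℝ ij.1).eval b /
        ((ascPochhammer ℝ ij.1).eval c * (Nat.factorial ij.1 : ℝ)) * x ^ ij.1)]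
  · refine sum_congr rfl ?_
    rintro ⟨i, j⟩ hij
    obtain rfl := mem_antidiagonal.1 hij
    have hi : (i.factorial : ℝ) ≠ 0 := Nat.cast_ne_zero.2 i.factorial_ne_zero
    simp only
    rw [ascPochhammer_eval_neg_natCast_add, neg_pow x, mul_right_comm, mul_div_mul_right _ _ hi]
    ring
  · intro k hk
    have h : (ascPochhammer ℝ k).eval (-(n : ℝ)) = 0 :=
      ascPochhammer_eval_neg_coe_nat_of_lt (by rw [mem_range] at hk; lia)
    simp [h]

theorem sum_ascPochhammer_mul_one_sub_pow (n : ℕ) (b d x : ℝ) :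
    ∑ ij ∈ antidiagonal n, (n.choose ij.1 : ℝ) *
        ((ascPochhammer ℝ ij.1).eval b * (ascPochhammer ℝ ij.2).eval d * (1 - x) ^ ij.1) =
      ∑ ij ∈ antidiagonal n, (n.choose ij.1 : ℝ) *
        ((ascPochhammer ℝ ij.1).eval b * (ascPochhammer ℝ ij.2).eval (b + d + ij.1) *
          (-x) ^ ij.1) := by
  induction n generalizing b d with
  | zero => simp
  | succ n ih =>
    have hl := sum_antidiagonal_choose_succ_mul (fun i j =>
      (ascPochhammer ℝ i).eval b * (ascPochhammer ℝ j).eval d * (1 - x) ^ i) n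
    have hr := sum_antidiagonal_choose_succ_mul (fun i j =>
      (ascPochhammer ℝ i).eval b * (ascPochhammer ℝ j).eval (b + d + i) * (-x) ^ i) n
    have h₁ := congrArg (d * ·) (ih b (d + 1))
    have h₂ := congrArg (b * (1 - x) * ·) (ih (b + 1) d)
    simp only [mul_sum] at h₁ h₂
    refine hl.trans (Eq.trans ?_ hr.symm)
    refine Eq.trans ?_ ((congrArg₂ (· + ·) h₁ h₂).trans ?_)
    · rw [← sum_add_distrib, ← sum_add_distrib]
      refine sum_congr rfl ?_
      rintro ⟨i, j⟩ hij
      simp only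
      rw [← Nat.choose_symm_of_eq_add (mem_antidiagonal.1 hij).symm,
        ascPochhammer_succ_eval_left i, ascPochhammer_succ_eval_left j]
      ring
    · rw [← sum_add_distrib, ← sum_add_distrib]
      refine sum_congr rfl ?_
      rintro ⟨i, j⟩ hij
      simp only
      have hb : b * (ascPochhammer ℝ i).eval (b + 1) = (ascPochhammer ℝ i).eval b * (b + i) := by
        rw [← ascPochhammer_succ_eval_left, ascPochhammer_succ_eval]
      have e₁ : b + (d + 1) + i = b + d + i + 1 := by ring
      have e₂ : b + 1 + d + i = b + d + i + 1 := by ring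
      have e₃ : b + d + ((i + 1 : ℕ) : ℝ) = b + d + i + 1 := by push_cast; ring
      rw [← Nat.choose_symm_of_eq_add (mem_antidiagonal.1 hij).symm,
        ascPochhammer_succ_eval_left i, ascPochhammer_succ_eval_left j, e₁, e₂, e₃]
      linear_combination (n.choose i : ℝ) * (ascPochhammer ℝ j).eval (b + d + i + 1) *
        (-x) ^ i * hb

theorem ascPochhammer_eval_mul_hyp2F1_neg_natCast (n : ℕ) (b c x : ℝ)
    (hc : ∀ i, (ascPochhammer ℝ i).eval c ≠ 0) :
    (ascPochhammer ℝ n).eval c * hyp2F1 (-(n : ℝ)) b c x =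
      ∑ ij ∈ antidiagonal n, (n.choose ij.1 : ℝ) *
        ((ascPochhammer ℝ ij.1).eval b * (ascPochhammer ℝ ij.2).eval (c + ij.1) *
          (-x) ^ ij.1) := by
  rw [hyp2F1_neg_natCast, mul_sum]
  refine sum_congr rfl ?_
  rintro ⟨i, j⟩ hij
  obtain rfl := mem_antidiagonal.1 hij
  have := hc i
  rw [ascPochhammer_eval_add_index]
  field_simp

theorem ascPochhammer_eval_mul_hyp2F1_neg_natCast_reflect (n : ℕ) (b d y : ℝ)
    (hd : ∀ i, (ascPochhammer ℝ i).eval (1 - d - n) ≠ 0) :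
    (ascPochhammer ℝ n).eval d * hyp2F1 (-(n : ℝ)) b (1 - d - n) y =
      ∑ ij ∈ antidiagonal n, (n.choose ij.1 : ℝ) *
        ((ascPochhammer ℝ ij.1).eval b * (ascPochhammer ℝ ij.2).eval d * y ^ ij.1) := by
  rw [hyp2F1_neg_natCast, mul_sum]
  refine sum_congr rfl ?_
  rintro ⟨i, j⟩ hij
  obtain rfl := mem_antidiagonal.1 hij
  have hi := hd i
  have h := ascPochhammer_eval_reflect i j d
  simp only at hi h ⊢
  rw [neg_pow y]
  field_simp
  linear_combination -((i + j).choose i : ℝ) * (ascPochhammer ℝ i).eval b * y ^ i * h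

theorem Real.Gamma_add_natCast (n : ℕ) (s : ℝ) (hs : ∀ m : ℕ, s ≠ -(m : ℝ)) :
    Real.Gamma (s + n) = (ascPochhammer ℝ n).eval s * Real.Gamma s := by
  induction n with
  | zero => simp
  | succ n ih =>
    have h : s + n ≠ 0 := fun h => hs n (eq_neg_of_add_eq_zero_left h)
    rw [ascPochhammer_succ_eval, Nat.cast_succ, ← add_assoc, Real.Gamma_add_one h, ih]
    ring

theorem ascPochhammer_eval_ne_zero (n : ℕ) (s : ℝ) (hs : ∀ m : ℕ, s ≠ -(m : ℝ)) :
    (ascPochhammer ℝ n).eval s ≠ 0 := by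
  rw [Ne, ascPochhammer_eval_eq_zero_iff]
  rintro ⟨k, -, hk⟩
  exact hs k (by rw [hk, neg_neg])


/-- Reflection formula for the Gaussian hypergeometric function: for `a = -n` a nonpositive
integer, `c` not a nonpositive integer and `c - b` not an integer,
`₂F₁(a,b;a+b+1-c;1-x) = Γ(c-a)Γ(c-b)/(Γ(c)Γ(c-a-b)) · ₂F₁(a,b;c;x)` for `0 < x < 1`. -/
theorem reflection_2F1 (n : ℕ) (a b c : ℝ) (ha : a = -(n : ℝ))
    (hc : ∀ m : ℕ, c ≠ -(m : ℝ)) (hcb : ∀ m : ℤ, c - b ≠ (m : ℝ)) :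
    ∀ x : ℝ, 0 < x → x < 1 →
      hyp2F1 a b (a + b + 1 - c) (1 - x) =
        Real.Gamma (c - a) * Real.Gamma (c - b) / (Real.Gamma c * Real.Gamma (c - a - b)) *
          hyp2F1 a b c x := by
  intro x _ _
  subst ha
  have hd : ∀ m : ℕ, c - b ≠ -(m : ℝ) := fun m => by simpa using hcb (-(m : ℤ))
  have hd' : ∀ m : ℕ, 1 - (c - b) - (n : ℝ) ≠ -(m : ℝ) := fun m h =>
    hcb (1 - n + m) (by push_cast; linear_combination -h)
  have hl := ascPochhammer_eval_mul_hyp2F1_neg_natCast_reflect n b (c - b) (1 - x)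
    fun i => ascPochhammer_eval_ne_zero i _ hd'
  have hr := ascPochhammer_eval_mul_hyp2F1_neg_natCast n b c x
    fun i => ascPochhammer_eval_ne_zero i _ hc
  have hs := sum_ascPochhammer_mul_one_sub_pow n b (c - b) x
  rw [add_sub_cancel, ← hl, ← hr] at hs
  have hpd := ascPochhammer_eval_ne_zero n _ hd
  have hΓc := Real.Gamma_ne_zero hc
  have hΓd := Real.Gamma_ne_zero hd
  have e₁ : -(n : ℝ) + b + 1 - c = 1 - (c - b) - n := by ring
  have e₂ : c - -(n : ℝ) - b = c - b + n := by ring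
  rw [e₁, e₂, sub_neg_eq_add, Real.Gamma_add_natCast n c hc,
    Real.Gamma_add_natCast n (c - b) hd]
  field_simp
  linear_combination hs
end

section
/- Let n be a nonnegative integer and set a = -n. Let b, c be real numbers such that c ∉ {0, -1, …, -n+1} and a+b+1-c ∉ {0, -1, …, -n+1}. Then there exists a real constant K, independent of x, such that for all x with 0 < x < 1, ₂F₁(a, b; a+b+1-c; 1-x) = K · ₂F₁(a, b; c; x); that is, the ratio ₂F₁(a,b;a+b+1-c;1-x) / ₂F₁(a,b;c;x) is independent of x wherever the denominator is nonzero. -/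
open Polynomial

/-- The hypergeometric differential operator
`p ↦ x (1 - x) p'' + (c - (a + b + 1) x) p' - a b p` on polynomials. -/
noncomputable def hypergeometricOperator (a b c : ℝ) (p : ℝ[X]) : ℝ[X] :=
  X * derivative (derivative p) - X * (X * derivative (derivative p)) + C c * derivative p
    - C (a + b + 1) * (X * derivative p) - C (a * b) * p

theorem coeff_hypergeometricOperator (a b c : ℝ) (p : ℝ[X]) (k : ℕ) :
    (hypergeometricOperator a b c p).coeff k =
      (k + 1) * (c + k) * p.coeff (k + 1) - (a + k) * (b + k) * p.coeff k := by
  unfold hypergeometricOperator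
  rcases k with _ | _ | m
  · simp only [coeff_sub, coeff_add, coeff_X_mul_zero, coeff_C_mul, coeff_derivative]
    push_cast
    ring
  · simp only [coeff_sub, coeff_add, coeff_X_mul, coeff_X_mul_zero, coeff_C_mul,
      coeff_derivative]
    push_cast
    ring
  · simp only [coeff_sub, coeff_add, coeff_X_mul, coeff_C_mul, coeff_derivative]
    push_cast
    ring

/-- Reflection `x ↦ 1 - x` exchanges the parameters `c` and `a + b + 1 - c`. -/
theorem hypergeometricOperator_comp_one_sub (a b c : ℝ) (p : ℝ[X]) :
    hypergeometricOperator a b c (p.comp (1 - X)) =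
      (hypergeometricOperator a b (a + b + 1 - c) p).comp (1 - X) := by
  simp only [hypergeometricOperator, derivative_comp, derivative_mul, derivative_sub,
    derivative_one, derivative_X, sub_comp, add_comp, mul_comp, X_comp, C_comp, derivative_neg,
    C_add, C_sub, C_1, zero_sub, one_comp]
  simp
  ring

/-- Polynomial solutions of degree at most `n` of the hypergeometric equation are determined by
their constant coefficient. -/
theorem eq_C_mul_of_hypergeometricOperator_eq_zero {a b c : ℝ} {n : ℕ} {p q : ℝ[X]}
    (hc : ∀ k : ℕ, k < n → c ≠ -(k : ℝ))
    (hp : hypergeometricOperator a b c p = 0) (hq : hypergeometricOperator a b c q = 0)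
    (hpn : p.natDegree ≤ n) (hqn : q.natDegree ≤ n) (hq0 : q.coeff 0 = 1) :
    p = C (p.coeff 0) * q := by
  have key : ∀ k ≤ n, p.coeff k = p.coeff 0 * q.coeff k := by
    intro k
    induction k with
    | zero => simp [hq0]
    | succ k ih =>
      intro hk
      have h1 := coeff_hypergeometricOperator a b c p k
      have h2 := coeff_hypergeometricOperator a b c q k
      rw [hp, coeff_zero, ih (by omega)] at h1
      rw [hq, coeff_zero] at h2
      have hck : c + k ≠ 0 := fun h => hc k hk (by linarith)
      have hne : ((k : ℝ) + 1) * (c + k) ≠ 0 := mul_ne_zero (by positivity) hck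
      apply mul_left_cancel₀ hne
      linear_combination p.coeff 0 * h2 - h1
  ext k
  rw [coeff_C_mul]
  rcases le_or_gt k n with hk | hk
  · exact key k hk
  · rw [coeff_eq_zero_of_natDegree_lt (hpn.trans_lt hk),
      coeff_eq_zero_of_natDegree_lt (hqn.trans_lt hk), mul_zero]

/-- The coefficient of `x ^ k` in `₂F₁(a, b; c; x)`. -/
noncomputable def hyp2F1Coeff (a b c : ℝ) (k : ℕ) : ℝ :=
  (ascPochhammer ℝ k).eval a * (ascPochhammer ℝ k).eval b /
    ((ascPochhammer ℝ k).eval c * (Nat.factorial k : ℝ))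

theorem hyp2F1Coeff_neg_eq_zero {n k : ℕ} (b c : ℝ) (h : n < k) :
    hyp2F1Coeff (-(n : ℝ)) b c k = 0 := by
  simp [hyp2F1Coeff, ascPochhammer_eval_neg_coe_nat_of_lt h]

theorem hyp2F1Coeff_succ (a b c : ℝ) {k : ℕ} (h : c + k ≠ 0) :
    (k + 1) * (c + k) * hyp2F1Coeff a b c (k + 1) = (a + k) * (b + k) * hyp2F1Coeff a b c k := by
  have hk : (k : ℝ) + 1 ≠ 0 := by positivity
  simp only [hyp2F1Coeff, ascPochhammer_succ_eval, Nat.factorial_succ]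
  push_cast
  by_cases h0 : (ascPochhammer ℝ k).eval c = 0
  · simp [h0]
  · field_simp

/-- The polynomial `₂F₁(-n, b; c; X)`. -/
noncomputable def hyp2F1Poly (n : ℕ) (b c : ℝ) : ℝ[X] :=
  ∑ k ∈ Finset.range (n + 1), C (hyp2F1Coeff (-(n : ℝ)) b c k) * X ^ k

theorem coeff_hyp2F1Poly (n : ℕ) (b c : ℝ) (k : ℕ) :
    (hyp2F1Poly n b c).coeff k = hyp2F1Coeff (-(n : ℝ)) b c k := by
  simp only [hyp2F1Poly, finsetSum_coeff, coeff_C_mul_X_pow, Finset.sum_ite_eq,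
    Finset.mem_range]
  split_ifs with h
  · rfl
  · exact (hyp2F1Coeff_neg_eq_zero b c (by omega)).symm

theorem natDegree_hyp2F1Poly_le (n : ℕ) (b c : ℝ) : (hyp2F1Poly n b c).natDegree ≤ n :=
  natDegree_le_iff_coeff_eq_zero.2 fun k hk => by
    rw [coeff_hyp2F1Poly, hyp2F1Coeff_neg_eq_zero b c hk]

theorem eval_hyp2F1Poly (n : ℕ) (b c x : ℝ) :
    (hyp2F1Poly n b c).eval x = hyp2F1 (-(n : ℝ)) b c x := by
  have h : hyp2F1 (-(n : ℝ)) b c x =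
      ∑ k ∈ Finset.range (n + 1), hyp2F1Coeff (-(n : ℝ)) b c k * x ^ k :=
    tsum_eq_sum fun k hk => by
      have h0 := hyp2F1Coeff_neg_eq_zero b c (show n < k by simpa using hk)
      rw [hyp2F1Coeff] at h0
      rw [h0, zero_mul]
  simp [h, hyp2F1Poly, eval_finsetSum]

theorem hypergeometricOperator_hyp2F1Poly {n : ℕ} (b : ℝ) {c : ℝ}
    (hc : ∀ k : ℕ, k < n → c ≠ -(k : ℝ)) :
    hypergeometricOperator (-(n : ℝ)) b c (hyp2F1Poly n b c) = 0 := by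
  ext k
  rw [coeff_hypergeometricOperator, coeff_hyp2F1Poly, coeff_hyp2F1Poly, coeff_zero, sub_eq_zero]
  rcases lt_trichotomy k n with hk | rfl | hk
  · exact hyp2F1Coeff_succ _ _ _ fun h => hc k hk (by linarith)
  · simp [hyp2F1Coeff_neg_eq_zero b c (Nat.lt_succ_self k)]
  · simp [hyp2F1Coeff_neg_eq_zero b c hk, hyp2F1Coeff_neg_eq_zero b c (hk.trans k.lt_succ_self)]

/-- The Whittaker–Watson ratio statement: for `a = -n` a nonpositive integer, with
`c ∉ {0, -1, …, -n+1}` and `a+b+1-c ∉ {0, -1, …, -n+1}`, there is a constant `K`,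
independent of `x`, such that `₂F₁(a,b;a+b+1-c;1-x) = K · ₂F₁(a,b;c;x)` for `0 < x < 1`. -/
theorem reflection_2F1_ratio_const (n : ℕ) (a b c : ℝ) (ha : a = -(n : ℝ))
    (hc : ∀ k : ℕ, k < n → c ≠ -(k : ℝ))
    (hc' : ∀ k : ℕ, k < n → a + b + 1 - c ≠ -(k : ℝ)) :
    ∃ K : ℝ, ∀ x : ℝ, 0 < x → x < 1 →
      hyp2F1 a b (a + b + 1 - c) (1 - x) = K * hyp2F1 a b c x := by
  subst ha
  set p := (hyp2F1Poly n b (-(n : ℝ) + b + 1 - c)).comp (1 - X) with hp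
  have hdeg : (1 - X : ℝ[X]).natDegree ≤ 1 := by compute_degree
  have hpn : p.natDegree ≤ n :=
    natDegree_comp_le.trans <| (Nat.mul_le_mul (natDegree_hyp2F1Poly_le _ _ _) hdeg).trans_eq
      (mul_one n)
  have hpL : hypergeometricOperator (-(n : ℝ)) b c p = 0 := by
    rw [hp, hypergeometricOperator_comp_one_sub, hypergeometricOperator_hyp2F1Poly b hc',
      zero_comp]
  have h := eq_C_mul_of_hypergeometricOperator_eq_zero hc hpL
    (hypergeometricOperator_hyp2F1Poly b hc) hpn (natDegree_hyp2F1Poly_le n b c)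
    (by simp [coeff_hyp2F1Poly, hyp2F1Coeff])
  refine ⟨p.coeff 0, fun x _ _ => ?_⟩
  have hx := congrArg (eval x) h
  rw [eval_mul, eval_C, eval_hyp2F1Poly] at hx
  rw [← hx, ← eval_hyp2F1Poly, hp, eval_comp]
  simp
end

section
/- Let n be a nonnegative integer and set a = -n. Let b, c be real numbers such that neither c nor c - b is an integer. Then for all x₁, x₂ with 0 < x₁, x₂ < 1 and x₁ ≠ x₂: G(a, b; a+b+2-c; 1-x₁, 1-x₂) = [Γ₂(c-a)·Γ₂(c-b) / (Γ₂(c)·Γ₂(c-a-b))] · G(a, b; c; x₁, x₂). (This is the reflection formula for the Gaussian hypergeometric function of 2×2 Hermitian matrix argument, expressed via its determinantal representation; the parameter shift c ↦ a+b+2-c corresponds to the shift c ↦ a+b+1-c+(m-1)d with m = 2 and d = 1.) -/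
/-- The Gaussian hypergeometric function of a `2 × 2` Hermitian matrix argument with
eigenvalues `u₁, u₂`, via its determinantal representation. -/
noncomputable def hypMat2 (p q r u₁ u₂ : ℝ) : ℝ :=
  (u₁ * hyp2F1 p q r u₁ * hyp2F1 (p - 1) (q - 1) (r - 1) u₂ -
    u₂ * hyp2F1 p q r u₂ * hyp2F1 (p - 1) (q - 1) (r - 1) u₁) / (u₁ - u₂)

/-- The `2 × 2` Hermitian multivariate gamma function `Γ₂(s) = π Γ(s) Γ(s-1)`. -/
noncomputable def Gamma2 (s : ℝ) : ℝ := Real.pi * Real.Gamma s * Real.Gamma (s - 1)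

/-- The coefficient of `x ^ k` in `₂F₁(a, b; c; x)`. -/
noncomputable def hypCoeff (a b c : ℝ) (k : ℕ) : ℝ :=
  (ascPochhammer ℝ k).eval a * (ascPochhammer ℝ k).eval b /
    ((ascPochhammer ℝ k).eval c * (Nat.factorial k : ℝ))

/-- The polynomial `₂F₁(-n, b; c; X)`. -/
noncomputable def hypPoly (n : ℕ) (b c : ℝ) : Polynomial ℝ :=
  ∑ k ∈ Finset.range (n + 1), Polynomial.monomial k (hypCoeff (-(n : ℝ)) b c k)

lemma hypCoeff_neg_nat_of_lt {n k : ℕ} (h : n < k) (b c : ℝ) :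
    hypCoeff (-(n : ℝ)) b c k = 0 := by
  simp [hypCoeff, ascPochhammer_eval_neg_coe_nat_of_lt h]

lemma coeff_hypPoly (n : ℕ) (b c : ℝ) (k : ℕ) :
    (hypPoly n b c).coeff k = hypCoeff (-(n : ℝ)) b c k := by
  simp only [hypPoly, Polynomial.finsetSum_coeff, Polynomial.coeff_monomial,
    Finset.sum_ite_eq', Finset.mem_range]
  split_ifs with h
  · rfl
  · exact (hypCoeff_neg_nat_of_lt (by omega) b c).symm

lemma hyp2F1_neg_nat (n : ℕ) (b c x : ℝ) :
    hyp2F1 (-(n : ℝ)) b c x = (hypPoly n b c).eval x := by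
  rw [hyp2F1, tsum_eq_sum (s := Finset.range (n + 1)), hypPoly, Polynomial.eval_finsetSum]
  · simp [hypCoeff, Polynomial.eval_monomial]
  · intro k hk
    have := hypCoeff_neg_nat_of_lt (n := n) (k := k) (by simpa using hk) b c
    rw [hypCoeff] at this
    rw [this, zero_mul]

lemma ascPochhammer_eval_succ_left (x : ℝ) (k : ℕ) :
    (ascPochhammer ℝ (k + 1)).eval x = x * (ascPochhammer ℝ k).eval (x + 1) := by
  simp [ascPochhammer_succ_left]

lemma ascPochhammer_eval_shift (x : ℝ) (k : ℕ) :
    x * (ascPochhammer ℝ k).eval (x + 1) = (ascPochhammer ℝ k).eval x * (x + k) := by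
  rw [← ascPochhammer_eval_succ_left, ascPochhammer_succ_eval]

lemma add_nat_ne_zero_of_ne_int {c : ℝ} (hc : ∀ m : ℤ, c ≠ m) (k : ℕ) : c + k ≠ 0 := by
  intro h
  apply hc (-k)
  push_cast
  linarith

lemma ne_zero_of_ne_int {c : ℝ} (hc : ∀ m : ℤ, c ≠ m) : c ≠ 0 := by
  simpa using hc 0

lemma ne_int_add_int {c : ℝ} (hc : ∀ m : ℤ, c ≠ m) (j : ℤ) : ∀ m : ℤ, c + j ≠ m := by
  intro m h
  apply hc (m - j)
  push_cast
  linarith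

lemma ascPochhammer_eval_ne_zero_s4 {c : ℝ} (hc : ∀ m : ℤ, c ≠ m) (k : ℕ) :
    (ascPochhammer ℝ k).eval c ≠ 0 := by
  induction k with
  | zero => simp
  | succ k ih =>
    rw [ascPochhammer_succ_eval]
    exact mul_ne_zero ih (add_nat_ne_zero_of_ne_int hc k)

lemma hypCoeff_zero (a b c : ℝ) : hypCoeff a b c 0 = 1 := by
  simp [hypCoeff]

lemma hypCoeff_contiguous_numerator {c : ℝ} (hc : ∀ m : ℤ, c ≠ m) (a b : ℝ) (k : ℕ) :
    hypCoeff (a - 1) b c (k + 1) =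
      hypCoeff a b c (k + 1) - b / c * hypCoeff a (b + 1) (c + 1) k := by
  have h1 : (ascPochhammer ℝ (k + 1)).eval (a - 1) = (a - 1) * (ascPochhammer ℝ k).eval a := by
    rw [ascPochhammer_eval_succ_left, sub_add_cancel]
  have hc0 := ne_zero_of_ne_int hc
  have hc1 : (ascPochhammer ℝ k).eval (c + 1) ≠ 0 :=
    ascPochhammer_eval_ne_zero_s4 (by simpa using ne_int_add_int hc 1) k
  simp only [hypCoeff, h1, ascPochhammer_eval_succ_left b, ascPochhammer_eval_succ_left c,
    ascPochhammer_succ_eval k a, Nat.factorial_succ, Nat.cast_mul, Nat.cast_succ]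
  have hf : (k.factorial : ℝ) ≠ 0 := by positivity
  have hk : (k : ℝ) + 1 ≠ 0 := by positivity
  field_simp
  ring

lemma hypCoeff_contiguous_reflected {e : ℝ} (he : ∀ m : ℤ, e ≠ m) (a b : ℝ) (k : ℕ) :
    -e * hypCoeff (a - 1) b e (k + 1) =
      (b - e) * hypCoeff a b (e + 1) (k + 1) -
        b * (hypCoeff a (b + 1) (e + 1) (k + 1) - hypCoeff a (b + 1) (e + 1) k) := by
  have h1 : (ascPochhammer ℝ (k + 1)).eval (a - 1) = (a - 1) * (ascPochhammer ℝ k).eval a := by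
    rw [ascPochhammer_eval_succ_left, sub_add_cancel]
  have he0 := ne_zero_of_ne_int he
  have he' : ∀ m : ℤ, e + 1 ≠ m := by simpa using ne_int_add_int he 1
  have he1 : (ascPochhammer ℝ k).eval (e + 1) ≠ 0 := ascPochhammer_eval_ne_zero_s4 he' k
  have he2 := add_nat_ne_zero_of_ne_int he' k
  simp only [hypCoeff, h1, ascPochhammer_eval_succ_left b, ascPochhammer_eval_succ_left e,
    ascPochhammer_succ_eval k a, ascPochhammer_succ_eval k (e + 1),
    ascPochhammer_succ_eval k (b + 1), Nat.factorial_succ, Nat.cast_mul, Nat.cast_succ]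
  have hf : (k.factorial : ℝ) ≠ 0 := by positivity
  have hk : (k : ℝ) + 1 ≠ 0 := by positivity
  field_simp
  ring

lemma hypCoeff_contiguous_denominator {c : ℝ} (hc : ∀ m : ℤ, c ≠ m) (a b : ℝ) (k : ℕ) :
    hypCoeff (a - 1) (b - 1) (c - 2) (k + 1) =
      hypCoeff (a - 1) (b - 1) (c - 1) (k + 1) +
        (a - 1) * (b - 1) / ((c - 1) * (c - 2)) * hypCoeff a b c k := by
  have hs (x : ℝ) : (ascPochhammer ℝ (k + 1)).eval (x - 1) =
      (x - 1) * (ascPochhammer ℝ k).eval x := by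
    rw [ascPochhammer_eval_succ_left, sub_add_cancel]
  have h2 : (ascPochhammer ℝ (k + 1)).eval (c - 2) =
      (c - 2) * (ascPochhammer ℝ k).eval (c - 1) := by
    rw [ascPochhammer_eval_succ_left]; congr 2; ring
  have hc1 : ∀ m : ℤ, c - 1 ≠ m := by simpa [sub_eq_add_neg] using ne_int_add_int hc (-1)
  have hc2 : c - 2 ≠ 0 := by
    have := hc 2
    push_cast at this
    exact sub_ne_zero.2 this
  have hc10 := ne_zero_of_ne_int hc1
  have hck := add_nat_ne_zero_of_ne_int hc1 k
  have hp := ascPochhammer_eval_ne_zero_s4 hc1 k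
  have h3 : (ascPochhammer ℝ k).eval c =
      (ascPochhammer ℝ k).eval (c - 1) * (c - 1 + k) / (c - 1) := by
    rw [eq_div_iff hc10, ← ascPochhammer_eval_shift, sub_add_cancel, mul_comm]
  simp only [hypCoeff, hs, h2, h3, Nat.factorial_succ, Nat.cast_mul, Nat.cast_succ]
  have hf : (k.factorial : ℝ) ≠ 0 := by positivity
  have hk : (k : ℝ) + 1 ≠ 0 := by positivity
  field_simp
  ring

lemma hypCoeff_contiguous_one_sub {c : ℝ} (hc : ∀ m : ℤ, c ≠ m) (a b : ℝ) (k : ℕ) :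
    hypCoeff a b (c - 1) (k + 1) - hypCoeff a b (c - 1) k =
      hypCoeff (a - 1) (b - 1) (c - 1) (k + 1) + (a + b - c) / (c - 1) * hypCoeff a b c k := by
  have hs (x : ℝ) : (ascPochhammer ℝ (k + 1)).eval (x - 1) =
      (x - 1) * (ascPochhammer ℝ k).eval x := by
    rw [ascPochhammer_eval_succ_left, sub_add_cancel]
  have hc1 : ∀ m : ℤ, c - 1 ≠ m := by simpa [sub_eq_add_neg] using ne_int_add_int hc (-1)
  have hc10 := ne_zero_of_ne_int hc1
  have hck := add_nat_ne_zero_of_ne_int hc1 k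
  have hp := ascPochhammer_eval_ne_zero_s4 hc1 k
  have h3 : (ascPochhammer ℝ k).eval c =
      (ascPochhammer ℝ k).eval (c - 1) * (c - 1 + k) / (c - 1) := by
    rw [eq_div_iff hc10, ← ascPochhammer_eval_shift, sub_add_cancel, mul_comm]
  simp only [hypCoeff, hs, h3, ascPochhammer_succ_eval k a, ascPochhammer_succ_eval k b,
    Nat.factorial_succ, Nat.cast_mul, Nat.cast_succ]
  have hf : (k.factorial : ℝ) ≠ 0 := by positivity
  have hk : (k : ℝ) + 1 ≠ 0 := by positivity
  field_simp
  ring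

lemma neg_cast_succ (n : ℕ) : (-((n + 1 : ℕ) : ℝ)) = -(n : ℝ) - 1 := by
  push_cast; ring

lemma hyp2F1_contiguous_numerator {c : ℝ} (hc : ∀ m : ℤ, c ≠ m) (n : ℕ) (b x : ℝ) :
    hyp2F1 (-((n + 1 : ℕ) : ℝ)) b c x =
      hyp2F1 (-(n : ℝ)) b c x - b / c * (x * hyp2F1 (-(n : ℝ)) (b + 1) (c + 1) x) := by
  have h : hypPoly (n + 1) b c =
      hypPoly n b c - Polynomial.C (b / c) * (Polynomial.X * hypPoly n (b + 1) (c + 1)) := by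
    ext k
    rcases k with _ | k
    · simp [coeff_hypPoly, hypCoeff_zero]
    · simp only [Polynomial.coeff_sub, Polynomial.coeff_C_mul, Polynomial.coeff_X_mul,
        coeff_hypPoly, neg_cast_succ]
      exact hypCoeff_contiguous_numerator hc _ _ _
  simp only [hyp2F1_neg_nat, h, Polynomial.eval_sub, Polynomial.eval_mul, Polynomial.eval_C,
    Polynomial.eval_X]

lemma hyp2F1_contiguous_reflected {e : ℝ} (he : ∀ m : ℤ, e ≠ m) (n : ℕ) (b y : ℝ) :
    -e * hyp2F1 (-((n + 1 : ℕ) : ℝ)) b e y =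
      (b - e) * hyp2F1 (-(n : ℝ)) b (e + 1) y -
        b * ((1 - y) * hyp2F1 (-(n : ℝ)) (b + 1) (e + 1) y) := by
  have h : Polynomial.C (-e) * hypPoly (n + 1) b e =
      Polynomial.C (b - e) * hypPoly n b (e + 1) - Polynomial.C b *
        (hypPoly n (b + 1) (e + 1) - Polynomial.X * hypPoly n (b + 1) (e + 1)) := by
    ext k
    rcases k with _ | k
    · simp [coeff_hypPoly, hypCoeff_zero, -map_neg, -map_sub]
    · simp only [Polynomial.coeff_sub, Polynomial.coeff_C_mul, Polynomial.coeff_X_mul,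
        coeff_hypPoly, neg_cast_succ]
      exact hypCoeff_contiguous_reflected he _ _ _
  have h' := congrArg (Polynomial.eval y) h
  simp only [Polynomial.eval_mul, Polynomial.eval_sub, Polynomial.eval_C, Polynomial.eval_X] at h'
  simp only [hyp2F1_neg_nat]
  rw [h']
  ring

lemma hyp2F1_contiguous_denominator {c : ℝ} (hc : ∀ m : ℤ, c ≠ m) (n : ℕ) (b x : ℝ) :
    hyp2F1 (-(n : ℝ) - 1) (b - 1) (c - 2) x =
      hyp2F1 (-(n : ℝ) - 1) (b - 1) (c - 1) x +
        (-(n : ℝ) - 1) * (b - 1) / ((c - 1) * (c - 2)) * (x * hyp2F1 (-(n : ℝ)) b c x) := by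
  have h : hypPoly (n + 1) (b - 1) (c - 2) = hypPoly (n + 1) (b - 1) (c - 1) +
      Polynomial.C ((-(n : ℝ) - 1) * (b - 1) / ((c - 1) * (c - 2))) *
        (Polynomial.X * hypPoly n b c) := by
    ext k
    rcases k with _ | k
    · simp [coeff_hypPoly, hypCoeff_zero]
    · simp only [Polynomial.coeff_add, Polynomial.coeff_C_mul, Polynomial.coeff_X_mul,
        coeff_hypPoly, neg_cast_succ]
      exact hypCoeff_contiguous_denominator hc _ _ _
  rw [← neg_cast_succ, hyp2F1_neg_nat, h, Polynomial.eval_add, Polynomial.eval_mul,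
    Polynomial.eval_mul, Polynomial.eval_C, Polynomial.eval_X, hyp2F1_neg_nat, hyp2F1_neg_nat,
    neg_cast_succ]

lemma hyp2F1_contiguous_one_sub {c : ℝ} (hc : ∀ m : ℤ, c ≠ m) (n : ℕ) (b x : ℝ) :
    (1 - x) * hyp2F1 (-(n : ℝ)) b (c - 1) x =
      hyp2F1 (-(n : ℝ) - 1) (b - 1) (c - 1) x +
        (-(n : ℝ) + b - c) / (c - 1) * (x * hyp2F1 (-(n : ℝ)) b c x) := by
  have h : hypPoly n b (c - 1) - Polynomial.X * hypPoly n b (c - 1) =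
      hypPoly (n + 1) (b - 1) (c - 1) +
        Polynomial.C ((-(n : ℝ) + b - c) / (c - 1)) * (Polynomial.X * hypPoly n b c) := by
    ext k
    rcases k with _ | k
    · simp [coeff_hypPoly, hypCoeff_zero]
    · simp only [Polynomial.coeff_add, Polynomial.coeff_sub, Polynomial.coeff_C_mul,
        Polynomial.coeff_X_mul, coeff_hypPoly, neg_cast_succ]
      exact hypCoeff_contiguous_one_sub hc _ _ _
  have h' := congrArg (Polynomial.eval x) h
  simp only [Polynomial.eval_mul, Polynomial.eval_sub, Polynomial.eval_add, Polynomial.eval_C,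
    Polynomial.eval_X] at h'
  simp only [← neg_cast_succ, hyp2F1_neg_nat]
  rw [← h']
  ring

/-- The reflection formula for terminating Gaussian hypergeometric series. -/
lemma hyp2F1_neg_nat_reflection (n : ℕ) (b c x : ℝ) (hc : ∀ m : ℤ, c ≠ m)
    (hcb : ∀ m : ℤ, c - b ≠ m) :
    (ascPochhammer ℝ n).eval c * hyp2F1 (-(n : ℝ)) b c x =
      (ascPochhammer ℝ n).eval (c - b) * hyp2F1 (-(n : ℝ)) b (b - n + 1 - c) (1 - x) := by
  induction n generalizing b c with
  | zero => simp only [hyp2F1_neg_nat]; simp [hypPoly, hypCoeff]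
  | succ n ih =>
    have hc0 := ne_zero_of_ne_int hc
    have h1 := ih b c hc hcb
    have h2 := ih (b + 1) (c + 1) (by simpa using ne_int_add_int hc 1) (by simpa using hcb)
    rw [show b + 1 - n + 1 - (c + 1) = b - n - c + 1 by ring,
      show c + 1 - (b + 1) = c - b by ring] at h2
    rw [show b - n + 1 - c = b - n - c + 1 by ring] at h1
    have he : ∀ m : ℤ, b - n - c ≠ m := by
      intro m h
      apply hcb (-m - n)
      push_cast
      linarith
    have h3 := hyp2F1_contiguous_reflected he n b (1 - x)
    rw [hyp2F1_contiguous_numerator hc]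
    have h4 := ascPochhammer_eval_shift c n
    rw [show b - ((n + 1 : ℕ) : ℝ) + 1 - c = b - n - c by push_cast; ring,
      ascPochhammer_succ_eval, ascPochhammer_succ_eval]
    generalize hyp2F1 (-((n + 1 : ℕ) : ℝ)) b (b - n - c) (1 - x) = L at *
    have h5 : (ascPochhammer ℝ n).eval c * (c + n) * (b / c) =
        b * (ascPochhammer ℝ n).eval (c + 1) := by
      rw [← h4]; field_simp
    linear_combination (c + n) * h1 - b * x * h2 -
      x * hyp2F1 (-(n : ℝ)) (b + 1) (c + 1) x * h5 - (ascPochhammer ℝ n).eval (c - b) * h3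

lemma Gamma_add_nat_eq_ascPochhammer {c : ℝ} (hc : ∀ m : ℤ, c ≠ m) (n : ℕ) :
    Real.Gamma (c + n) = (ascPochhammer ℝ n).eval c * Real.Gamma c := by
  induction n with
  | zero => simp
  | succ n ih =>
    rw [Nat.cast_succ, ← add_assoc, Real.Gamma_add_one (add_nat_ne_zero_of_ne_int hc n), ih,
      ascPochhammer_succ_eval]
    ring

lemma Gamma_ne_zero_of_ne_int {c : ℝ} (hc : ∀ m : ℤ, c ≠ m) : Real.Gamma c ≠ 0 :=
  Real.Gamma_ne_zero fun m => by simpa using hc (-m)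

/-- Reflection formula for the Gaussian hypergeometric function of `2 × 2` Hermitian matrix
argument: for `a = -n` a nonpositive integer, with neither `c` nor `c - b` an integer,
`G(a,b;a+b+2-c;1-x₁,1-x₂) = Γ₂(c-a)Γ₂(c-b)/(Γ₂(c)Γ₂(c-a-b)) · G(a,b;c;x₁,x₂)`
for distinct `x₁, x₂ ∈ (0,1)`. -/
theorem reflection_2F1_hermitian_2x2 (n : ℕ) (a b c : ℝ) (ha : a = -(n : ℝ))
    (hc : ∀ m : ℤ, c ≠ (m : ℝ)) (hcb : ∀ m : ℤ, c - b ≠ (m : ℝ)) :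
    ∀ x₁ x₂ : ℝ, 0 < x₁ → x₁ < 1 → 0 < x₂ → x₂ < 1 → x₁ ≠ x₂ →
      hypMat2 a b (a + b + 2 - c) (1 - x₁) (1 - x₂) =
        Gamma2 (c - a) * Gamma2 (c - b) / (Gamma2 c * Gamma2 (c - a - b)) *
          hypMat2 a b c x₁ x₂ := by
  intro x₁ x₂ _ _ _ _ hne
  subst ha
  have hc1 : ∀ m : ℤ, c - 1 ≠ m := by simpa [sub_eq_add_neg] using ne_int_add_int hc (-1)
  have hc2 : ∀ m : ℤ, c - 2 ≠ m := by simpa [sub_eq_add_neg] using ne_int_add_int hc (-2)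
  have hd1 : ∀ m : ℤ, c - b - 1 ≠ m := by simpa [sub_eq_add_neg] using ne_int_add_int hcb (-1)
  have hc10 := ne_zero_of_ne_int hc1
  have hc20 := ne_zero_of_ne_int hc2
  have hd10 := ne_zero_of_ne_int hd1
  set p := (ascPochhammer ℝ n).eval c with hp
  set q := (ascPochhammer ℝ n).eval (c - 1) with hq
  set r := (ascPochhammer ℝ n).eval (c - b) with hr
  set s := (ascPochhammer ℝ n).eval (c - b - 1) with hs
  have hr0 : r ≠ 0 := ascPochhammer_eval_ne_zero_s4 hcb n
  have hs0 : s ≠ 0 := ascPochhammer_eval_ne_zero_s4 hd1 n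
  have hpq : (c - 1) * p = q * (c - 1 + n) := by
    simpa using ascPochhammer_eval_shift (c - 1) n
  have hconst : Gamma2 (c - -(n : ℝ)) * Gamma2 (c - b) / (Gamma2 c * Gamma2 (c - -(n : ℝ) - b)) =
      p * q / (r * s) := by
    simp only [Gamma2]
    rw [show c - -(n : ℝ) = c + n by ring, show c + (n : ℝ) - 1 = c - 1 + n by ring,
      show c + (n : ℝ) - b = c - b + n by ring, show c - b + (n : ℝ) - 1 = c - b - 1 + n by ring,
      Gamma_add_nat_eq_ascPochhammer hc, Gamma_add_nat_eq_ascPochhammer hc1,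
      Gamma_add_nat_eq_ascPochhammer hcb, Gamma_add_nat_eq_ascPochhammer hd1]
    have := Gamma_ne_zero_of_ne_int hc
    have := Gamma_ne_zero_of_ne_int hc1
    have := Gamma_ne_zero_of_ne_int hcb
    have := Gamma_ne_zero_of_ne_int hd1
    have := Real.pi_ne_zero
    rw [← hp, ← hq, ← hr, ← hs]
    field_simp
  have R1 (x : ℝ) : hyp2F1 (-(n : ℝ)) b (-(n : ℝ) + b + 2 - c) (1 - x) =
      q / s * hyp2F1 (-(n : ℝ)) b (c - 1) x := by
    have h := hyp2F1_neg_nat_reflection n b (c - 1) x hc1 (by simpa [sub_right_comm] using hd1)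
    rw [show c - 1 - b = c - b - 1 by ring,
      show b - (n : ℝ) + 1 - (c - 1) = -(n : ℝ) + b + 2 - c by ring, ← hq, ← hs] at h
    field_simp
    linear_combination -h
  have R2 (x : ℝ) : hyp2F1 (-(n : ℝ) - 1) (b - 1) (-(n : ℝ) + b + 2 - c - 1) (1 - x) =
      (c - 2) * q / ((c - b - 1) * r) * hyp2F1 (-(n : ℝ) - 1) (b - 1) (c - 2) x := by
    have h := hyp2F1_neg_nat_reflection (n + 1) (b - 1) (c - 2) x hc2
      (by rw [show c - 2 - (b - 1) = c - b - 1 by ring]; exact hd1)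
    rw [show c - 2 - (b - 1) = c - b - 1 by ring,
      show b - 1 - ((n + 1 : ℕ) : ℝ) + 1 - (c - 2) = -(n : ℝ) + b + 2 - c - 1 by push_cast; ring,
      neg_cast_succ, ascPochhammer_eval_succ_left, ascPochhammer_eval_succ_left,
      show c - 2 + 1 = c - 1 by ring, sub_add_cancel, ← hq, ← hr] at h
    field_simp
    linear_combination -h
  rw [hconst]
  simp only [hypMat2]
  rw [R1, R1, R2, R2, hyp2F1_contiguous_denominator hc, hyp2F1_contiguous_denominator hc]
  have e1 := hyp2F1_contiguous_one_sub hc n b x₁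
  have e2 := hyp2F1_contiguous_one_sub hc n b x₂
  generalize hyp2F1 (-(n : ℝ)) b (c - 1) x₁ = E₁ at *
  generalize hyp2F1 (-(n : ℝ)) b (c - 1) x₂ = E₂ at *
  generalize hyp2F1 (-(n : ℝ)) b c x₁ = A₁ at *
  generalize hyp2F1 (-(n : ℝ)) b c x₂ = A₂ at *
  generalize hyp2F1 (-(n : ℝ) - 1) (b - 1) (c - 1) x₁ = B₁ at *
  generalize hyp2F1 (-(n : ℝ) - 1) (b - 1) (c - 1) x₂ = B₂ at *
  have hx : x₁ - x₂ ≠ 0 := sub_ne_zero.2 hne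
  have hp' : p = q * (c - 1 + n) / (c - 1) := by rw [eq_div_iff hc10, ← hpq, mul_comm]
  rw [show 1 - x₁ - (1 - x₂) = -(x₁ - x₂) by ring, ← mul_assoc, ← mul_assoc,
    show (1 - x₁) * (q / s) * E₁ = q / s * ((1 - x₁) * E₁) by ring,
    show (1 - x₂) * (q / s * E₂) = q / s * ((1 - x₂) * E₂) by ring, e1, e2, hp']
  field_simp
  ring
end

section
/- Let α be a real number and let x₁, x₂ ∈ (0,1). Then the limit, as (y₁, y₂) → (1, 1) with y₁ ≠ ±y₂, of [ (1+x₁y₁)^{-2α}(1+x₂y₂)^{-2α} - (1+x₁y₂)^{-2α}(1+x₂y₁)^{-2α} ] / (y₁² - y₂²) exists and equals α·(x₂ - x₁)·(1+x₁)^{-2α-1}·(1+x₂)^{-2α-1}. -/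
open Filter

/-- The difference quotients of a strictly differentiable function at two distinct points converge
to the derivative as both points approach the base point. -/
theorem HasStrictDerivAt.tendsto_div_sub {f : ℝ → ℝ} {f' a : ℝ} (h : HasStrictDerivAt f f' a) :
    Tendsto (fun p : ℝ × ℝ => (f p.1 - f p.2) / (p.1 - p.2))
      (nhdsWithin (a, a) {p : ℝ × ℝ | p.1 ≠ p.2}) (nhds f') := by
  have h0 := (h.hasStrictFDerivAt.isLittleO.tendsto_div_nhds_zero).mono_left
    (nhdsWithin_le_nhds (s := {p : ℝ × ℝ | p.1 ≠ p.2}))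
  have h1 := h0.add_const f'
  rw [zero_add] at h1
  refine h1.congr' ?_
  filter_upwards [self_mem_nhdsWithin] with p hp
  have hne : p.1 - p.2 ≠ 0 := sub_ne_zero.2 hp
  simp only [ContinuousLinearMap.toSpanSingleton_apply, smul_eq_mul]
  field_simp
  ring

/-- The confluent limit of a `2 × 2` determinant of functions divided by the Vandermonde factor in
the squares of the variables. -/
theorem HasStrictDerivAt.tendsto_det_div_sq_sub_sq {f g : ℝ → ℝ} {f' g' a : ℝ} (ha : a ≠ 0)
    (hf : HasStrictDerivAt f f' a) (hg : HasStrictDerivAt g g' a) :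
    Tendsto (fun p : ℝ × ℝ => (f p.1 * g p.2 - f p.2 * g p.1) / (p.1 ^ 2 - p.2 ^ 2))
      (nhdsWithin (a, a) {p : ℝ × ℝ | p.1 ≠ p.2 ∧ p.1 ≠ -p.2})
      (nhds ((f' * g a - f a * g') / (a + a))) := by
  have hle : nhdsWithin (a, a) {p : ℝ × ℝ | p.1 ≠ p.2 ∧ p.1 ≠ -p.2} ≤
      nhdsWithin (a, a) {p : ℝ × ℝ | p.1 ≠ p.2} := nhdsWithin_mono _ fun _ hp => hp.1
  have hsnd : Tendsto (fun p : ℝ × ℝ => p.2)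
      (nhdsWithin (a, a) {p : ℝ × ℝ | p.1 ≠ p.2 ∧ p.1 ≠ -p.2}) (nhds a) :=
    (continuous_snd.tendsto (a, a)).mono_left nhdsWithin_le_nhds
  have hadd : Tendsto (fun p : ℝ × ℝ => p.1 + p.2)
      (nhdsWithin (a, a) {p : ℝ × ℝ | p.1 ≠ p.2 ∧ p.1 ≠ -p.2}) (nhds (a + a)) :=
    ((continuous_fst.add continuous_snd).tendsto (a, a)).mono_left nhdsWithin_le_nhds
  have hlim := (((hf.tendsto_div_sub.mono_left hle).mul
    (hg.hasDerivAt.continuousAt.tendsto.comp hsnd)).sub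
    ((hf.hasDerivAt.continuousAt.tendsto.comp hsnd).mul
      (hg.tendsto_div_sub.mono_left hle))).div hadd (by simpa using ha)
  refine hlim.congr' ?_
  filter_upwards [self_mem_nhdsWithin] with p hp
  have hsub : p.1 - p.2 ≠ 0 := sub_ne_zero.2 hp.1
  have hadd' : p.1 + p.2 ≠ 0 := fun h => hp.2 (eq_neg_of_add_eq_zero_left h)
  have hsq : p.1 ^ 2 - p.2 ^ 2 = (p.1 - p.2) * (p.1 + p.2) := by ring
  simp only [Function.comp_apply, Pi.div_apply]
  rw [hsq]
  field_simp
  ring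

theorem hasStrictDerivAt_one_add_mul_rpow {x : ℝ} (s : ℝ) {y : ℝ} (h : 1 + x * y ≠ 0) :
    HasStrictDerivAt (fun y : ℝ => (1 + x * y) ^ s) (s * (1 + x * y) ^ (s - 1) * x) y := by
  have hlin : HasStrictDerivAt (fun y : ℝ => 1 + x * y) x y := by
    simpa using ((hasStrictDerivAt_id y).const_mul x).const_add 1
  exact (Real.hasStrictDerivAt_rpow_const_of_ne h s).comp y hlin

/-- The limit, as `(y₁, y₂) → (1, 1)` with `y₁ ≠ ±y₂`, of
`det((1 + xᵢ yⱼ)^{-2α}) / (y₁² - y₂²)` exists and equals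
`α (x₂ - x₁) (1 + x₁)^{-2α-1} (1 + x₂)^{-2α-1}`, for `x₁, x₂ ∈ (0, 1)`. -/
theorem power_det_vandermonde_limit (α x₁ x₂ : ℝ)
    (hx₁ : 0 < x₁) (hx₁' : x₁ < 1) (hx₂ : 0 < x₂) (hx₂' : x₂ < 1) :
    Tendsto
      (fun p : ℝ × ℝ =>
        ((1 + x₁ * p.1) ^ (-2 * α) * (1 + x₂ * p.2) ^ (-2 * α) -
            (1 + x₁ * p.2) ^ (-2 * α) * (1 + x₂ * p.1) ^ (-2 * α)) /
          (p.1 ^ 2 - p.2 ^ 2))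
      (nhdsWithin ((1 : ℝ), (1 : ℝ)) {p : ℝ × ℝ | p.1 ≠ p.2 ∧ p.1 ≠ -p.2})
      (nhds (α * (x₂ - x₁) * (1 + x₁) ^ (-2 * α - 1) * (1 + x₂) ^ (-2 * α - 1))) := by
  have h₁ : 0 < 1 + x₁ := by linarith
  have h₂ : 0 < 1 + x₂ := by linarith
  have hlim := HasStrictDerivAt.tendsto_det_div_sq_sub_sq one_ne_zero
    (hasStrictDerivAt_one_add_mul_rpow (x := x₁) (-2 * α) (y := 1) (by simpa using h₁.ne'))
    (hasStrictDerivAt_one_add_mul_rpow (x := x₂) (-2 * α) (y := 1) (by simpa using h₂.ne'))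
  convert hlim using 2
  have hpow {t : ℝ} (ht : 0 < t) : t ^ (-2 * α) = t ^ (-2 * α - 1) * t := by
    rw [← Real.rpow_add_one ht.ne', sub_add_cancel]
  rw [mul_one, mul_one, hpow h₁, hpow h₂]
  ring
end
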